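/- Let X, X̃ and Ŷ be finite nonempty types, and let g : X → Ŷ and g̃ : X̃ → Ŷ be surjective functions. Let p : X → ℝ and p̃ : X̃ → ℝ be probability mass functions (nonnegative, summing to 1), and suppose their pushforwards agree: there is a probability mass function p̂ : Ŷ → ℝ with p̂(ŷ) = ∑_{x : g(x) = ŷ} p(x) = ∑_{x̃ : g̃(x̃) = ŷ} p̃(x̃) for every ŷ ∈ Ŷ. Then the absolute difference of Shannon entropies satisfies |H(p) - H(p̃)| ≤ max(H(p), H(p̃)) - H(p̂). -/

import Mathlib

open Real

lemma entropy_push_le {X Y : Type*} [Fintype X] [Fintype Y] [DecidableEq Y]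
    (g : X → Y) (p : X → ℝ) (hp0 : ∀ x, 0 ≤ p x) (phat : Y → ℝ)
    (hpush : ∀ y, phat y = ∑ x ∈ Finset.univ.filter (fun x => g x = y), p x) :
    ∑ y, negMulLog (phat y) ≤ ∑ x, negMulLog (p x) := by
  rw [← Finset.sum_fiberwise (s := Finset.univ) (g := g) (f := fun x => negMulLog (p x))]
  refine Finset.sum_le_sum fun y _ => ?_
  have h1 : negMulLog (phat y)
      = ∑ x ∈ Finset.univ.filter (fun x => g x = y), -(p x) * log (phat y) := by
    rw [← Finset.sum_mul, Finset.sum_neg_distrib, ← hpush y, negMulLog]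
  rw [h1]
  refine Finset.sum_le_sum fun x hx => ?_
  have hle : p x ≤ phat y := by
    rw [hpush y]
    exact Finset.single_le_sum (f := p) (fun i _ => hp0 i) hx
  rcases (hp0 x).eq_or_lt with h | h
  · simp [negMulLog, ← h]
  · have := mul_le_mul_of_nonneg_left (log_le_log h hle) h.le
    rw [negMulLog]
    linarith

/-- Theorem 1 of the paper: the absolute difference of the entropies of two pmfs
with a common pushforward is bounded by the maximum of the entropies minus the
entropy of the common pushforward. -/
theorem abs_entropy_diff_le
    {X X' Y : Type*} [Fintype X] [Fintype X'] [Fintype Y]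
    [Nonempty X] [Nonempty X'] [Nonempty Y] [DecidableEq Y]
    (g : X → Y) (hg : Function.Surjective g)
    (g' : X' → Y) (hg' : Function.Surjective g')
    (p : X → ℝ) (hp0 : ∀ x, 0 ≤ p x) (hp1 : ∑ x, p x = 1)
    (p' : X' → ℝ) (hp'0 : ∀ x, 0 ≤ p' x) (hp'1 : ∑ x, p' x = 1)
    (phat : Y → ℝ) (hphat0 : ∀ y, 0 ≤ phat y) (hphat1 : ∑ y, phat y = 1)
    (hpush : ∀ y, phat y = ∑ x ∈ Finset.univ.filter (fun x => g x = y), p x)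
    (hpush' : ∀ y, phat y = ∑ x ∈ Finset.univ.filter (fun x => g' x = y), p' x) :
    |(∑ x, negMulLog (p x)) - (∑ x, negMulLog (p' x))|
      ≤ max (∑ x, negMulLog (p x)) (∑ x, negMulLog (p' x))
          - ∑ y, negMulLog (phat y) := by
  have h1 := entropy_push_le g p hp0 phat hpush
  have h2 := entropy_push_le g' p' hp'0 phat hpush'
  rw [abs_le]
  have h3 := le_max_left (∑ x, negMulLog (p x)) (∑ x, negMulLog (p' x))
  have h4 := le_max_right (∑ x, negMulLog (p x)) (∑ x, negMulLog (p' x))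
  constructor <;> linarith
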